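/- (Dirac's theorem) A finite simple graph G on [n] is chordal if and only if G is the 1-skeleton of a quasi-tree on [n], i.e., there exists a quasi-tree Δ on [n] whose 2-element faces are exactly the edges of G. -/

import Mathlib

open Finset

/-- A simplicial complex on the vertex set `Fin n`: contains all singletons and is
closed under taking subsets. -/
def IsComplex {n : ℕ} (Δ : Set (Finset (Fin n))) : Prop :=
  (∀ i : Fin n, {i} ∈ Δ) ∧ ∀ F ∈ Δ, ∀ G ⊆ F, G ∈ Δ

/-- Closed under taking subsets (a simplicial complex, singletons not required). -/
def IsLowerComplex {n : ℕ} (Δ : Set (Finset (Fin n))) : Prop :=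
  ∀ F ∈ Δ, ∀ G ⊆ F, G ∈ Δ

/-- The set of facets (maximal faces) of `Δ`. -/
def facets {n : ℕ} (Δ : Set (Finset (Fin n))) : Set (Finset (Fin n)) :=
  {F | F ∈ Δ ∧ ∀ G ∈ Δ, F ⊆ G → F = G}

/-- The simplicial complex generated by a family of subsets of `Fin n`. -/
def gen {n : ℕ} (S : Set (Finset (Fin n))) : Set (Finset (Fin n)) :=
  {G | ∃ F ∈ S, G ⊆ F}

/-- `F` is a leaf of `Δ`: either `F` is the only facet, or there is a facet `G ≠ F`
(a branch of `F`) with `H ∩ F ⊆ G ∩ F` for every facet `H ≠ F`. -/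
def IsLeaf {n : ℕ} (Δ : Set (Finset (Fin n))) (F : Finset (Fin n)) : Prop :=
  F ∈ facets Δ ∧
    (facets Δ = {F} ∨ ∃ G ∈ facets Δ, G ≠ F ∧ ∀ H ∈ facets Δ, H ≠ F → H ∩ F ⊆ G ∩ F)

/-- `Δ` is a quasi-tree: there is a labeling `F₁, …, F_m` of its facets such that `F_i`
is a leaf of `⟨F₁, …, F_i⟩` for every `i` (a leaf order). -/
def IsQuasiTree {n : ℕ} (Δ : Set (Finset (Fin n))) : Prop :=
  ∃ L : List (Finset (Fin n)), L.Nodup ∧ {F | F ∈ L} = facets Δ ∧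
    ∀ i : Fin L.length, IsLeaf (gen {F | F ∈ L.take (i.1 + 1)}) (L.get i)

/-- `Δ` is pure: all facets have the same cardinality. -/
def IsPure {n : ℕ} (Δ : Set (Finset (Fin n))) : Prop :=
  ∀ F ∈ facets Δ, ∀ G ∈ facets Δ, F.card = G.card

/-- `Δ` is shellable: it is pure and there is an order `F₁, …, F_m` of its facets such
that for all `j < i` and `x ∈ F_i \ F_j` there is `k < i` with `F_i \ F_k = {x}`. -/
def IsShellable {n : ℕ} (Δ : Set (Finset (Fin n))) : Prop :=
  IsPure Δ ∧ ∃ L : List (Finset (Fin n)), L.Nodup ∧ {F | F ∈ L} = facets Δ ∧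
    ∀ i j : Fin L.length, j < i →
      ∀ x ∈ L.get i \ L.get j, ∃ k : Fin L.length, k < i ∧ L.get i \ L.get k = {x}

/-- The `i`-skeleton of `Δ`: the complex generated by the faces of dimension `i`. -/
def skel {n : ℕ} (Δ : Set (Finset (Fin n))) (i : ℕ) : Set (Finset (Fin n)) :=
  gen {F | F ∈ Δ ∧ F.card = i + 1}

/-- The Alexander dual of `Δ`: `Δ^∨ = {[n] \ F : F ∉ Δ}`. -/
def dual {n : ℕ} (Δ : Set (Finset (Fin n))) : Set (Finset (Fin n)) :=
  {G | Gᶜ ∉ Δ}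

/-- `Δ^c`, the complex generated by the complements of the facets of `Δ`. -/
def complements {n : ℕ} (Δ : Set (Finset (Fin n))) : Set (Finset (Fin n)) :=
  gen ((·ᶜ) '' facets Δ)

/-- `Δ` is flag: every minimal nonface has exactly two elements. -/
def IsFlag {n : ℕ} (Δ : Set (Finset (Fin n))) : Prop :=
  ∀ F : Finset (Fin n), F ∉ Δ → (∀ G ⊂ F, G ∈ Δ) → F.card = 2

/-- The squarefree monomial `x_F = ∏_{i ∈ F} x_i`. -/
noncomputable def xF {n : ℕ} (K : Type) [Field K] (F : Finset (Fin n)) :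
    MvPolynomial (Fin n) K := ∏ i ∈ F, MvPolynomial.X i

/-- The Stanley–Reisner ideal of `Δ`, generated by the monomials `x_F` with `F` a
nonface of `Δ`. -/
noncomputable def SRIdeal {n : ℕ} (K : Type) [Field K] (Δ : Set (Finset (Fin n))) :
    Ideal (MvPolynomial (Fin n) K) := Ideal.span (xF K '' {F | F ∉ Δ})

/-- The facet ideal of `Δ`, generated by the monomials `x_F` with `F` a facet of `Δ`. -/
noncomputable def facetIdeal {n : ℕ} (K : Type) [Field K] (Δ : Set (Finset (Fin n))) :
    Ideal (MvPolynomial (Fin n) K) := Ideal.span (xF K '' facets Δ)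

/-- A set `G` of monomials (assumed to be the minimal monomial generating set of the
ideal it generates) has linear quotients: there is an order `f₁, …, f_m` of `G` such
that each colon ideal `(f₁,…,f_{i-1}) : f_i` is generated by a set of variables. -/
def HasLinearQuotients {n : ℕ} (K : Type) [Field K]
    (G : Set (MvPolynomial (Fin n) K)) : Prop :=
  ∃ L : List (MvPolynomial (Fin n) K), L.Nodup ∧ {f | f ∈ L} = G ∧
    ∀ i : Fin L.length, 0 < i.1 →
      ∃ V : Set (Fin n),
        Submodule.colon (Ideal.span {f | f ∈ L.take i.1}) (Ideal.span {L.get i}) =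
          Ideal.span (MvPolynomial.X '' V)

/-- The clique complex `Δ(G)` of a graph `G`: faces are the cliques of `G`. -/
def cliqueComplex {n : ℕ} (G : SimpleGraph (Fin n)) : Set (Finset (Fin n)) :=
  {F | ∀ i ∈ F, ∀ j ∈ F, i ≠ j → G.Adj i j}

/-- A graph is chordal if every cycle of length at least 4 has a chord, i.e. an edge of
the graph joining two vertices of the cycle which is not an edge of the cycle. -/
def IsChordalGraph {V : Type} (G : SimpleGraph V) : Prop :=
  ∀ (v : V) (c : G.Walk v v), c.IsCycle → 4 ≤ c.length →
    ∃ x y, G.Adj x y ∧ x ∈ c.support ∧ y ∈ c.support ∧ s(x, y) ∉ c.edges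

/-- A module `M` over `S` has projective dimension at most one: some (equivalently, by
Schanuel's lemma, any) presentation of `M` by a free module has projective kernel. -/
def ProjDimLEOne (S : Type) [CommRing S] (M : Type) [AddCommGroup M] [Module S M] : Prop :=
  ∃ (ι : Type) (f : (ι →₀ S) →ₗ[S] M), Function.Surjective f ∧
    Module.Projective S (LinearMap.ker f)

/-- The monomial with exponent vector `a`. -/
noncomputable def mono {n : ℕ} (K : Type) [Field K] (a : Fin n → ℕ) :
    MvPolynomial (Fin n) K := MvPolynomial.monomial (Finsupp.equivFunOnFinite.symm a) 1

/-- The Taylor relation `r_{ij} = u_{ji} e_i - u_{ij} e_j` for the monomials with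
exponent vectors `a i`, `a j`, where `u_{ij} = u_i / gcd(u_i, u_j)`. -/
noncomputable def taylorRel {n t : ℕ} (K : Type) [Field K] (a : Fin t → Fin n → ℕ)
    (i j : Fin t) : Fin t → MvPolynomial (Fin n) K :=
  Pi.single i (mono K (a j - a i ⊓ a j)) - Pi.single j (mono K (a i - a i ⊓ a j))

open SimpleGraph

/-- A shortest walk is an induced path: every edge between two of its vertices is one of its
edges. -/
theorem SimpleGraph.Walk.mem_edges_of_length_eq_dist {V : Type} {H : SimpleGraph V} {u v : V}
    (p : H.Walk u v) (hp : p.length = H.dist u v) {x y : V} (hx : x ∈ p.support)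
    (hy : y ∈ p.support) (hxy : H.Adj x y) : s(x, y) ∈ p.edges := by
  obtain ⟨i, rfl, hi⟩ := Walk.mem_support_iff_exists_getVert.1 hx
  obtain ⟨j, rfl, hj⟩ := Walk.mem_support_iff_exists_getVert.1 hy
  wlog hij : i < j generalizing i j
  · rw [Sym2.eq_swap]
    rcases (not_lt.1 hij).lt_or_eq with h | rfl
    · exact this j hj hy i hi hx hxy.symm h
    · exact absurd hxy (H.irrefl)
  have hle : H.dist u v ≤ ((p.take i).append (Walk.cons hxy (p.drop j))).length :=
    SimpleGraph.dist_le _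
  simp only [Walk.length_append, Walk.length_cons, Walk.take_length, Walk.drop_length] at hle
  obtain rfl : j = i + 1 := by omega
  rw [← Walk.adj_toSubgraph_iff_mem_edges, Walk.toSubgraph_adj_iff]
  exact ⟨i, rfl, by omega⟩

/-- In a chordal graph, two neighbours of a connected set `A` having a common neighbour away
from `A` are adjacent. -/
theorem IsChordalGraph.adj_of_connected {V : Type} {G : SimpleGraph V} (hG : IsChordalGraph G)
    {A : Set V} (hA : ∀ a ∈ A, ∀ a' ∈ A, (G.induce A).spanningCoe.Reachable a a')
    {b x y a a' : V} (hbA : b ∉ A) (hb : ∀ a ∈ A, ¬ G.Adj b a) (ha : a ∈ A) (ha' : a' ∈ A)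
    (hxa : G.Adj x a) (hya : G.Adj y a') (hbx : G.Adj b x) (hby : G.Adj b y) (hxy : x ≠ y) :
    G.Adj x y := by
  by_contra hn
  set T : Set V := insert x (insert y A) with hT
  set H := (G.induce T).spanningCoe with hH
  have hadj : ∀ p q, H.Adj p q ↔ G.Adj p q ∧ p ∈ T ∧ q ∈ T := by
    intro p q; simp [hH]
  have hHG : H ≤ G := fun p q h => ((hadj p q).1 h).1
  have hmono : (G.induce A).spanningCoe ≤ H := by
    intro p q h
    rw [hadj]
    simp at h
    simp [hT, h]
  have hreach : H.Reachable x y :=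
    ((hadj x a).2 ⟨hxa, by simp [hT], by simp [hT, ha]⟩).reachable.trans
      (((hA a ha a' ha').mono hmono).trans
        ((hadj a' y).2 ⟨hya.symm, by simp [hT, ha'], by simp [hT]⟩).reachable)
  obtain ⟨p, hp, hlen⟩ := hreach.exists_path_of_dist
  have hsupp : ∀ z ∈ p.support, z ∈ T := by
    intro z hz
    have hnn : ¬ p.Nil := Walk.not_nil_of_ne hxy
    obtain ⟨w, hw⟩ : ∃ w, H.Adj z w := by
      obtain ⟨e, he, hze⟩ := (Walk.mem_support_iff_exists_mem_edges_of_not_nil hnn).1 hz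
      induction e with | _ q r =>
      have := p.adj_of_mem_edges he
      rcases Sym2.mem_iff.1 hze with rfl | rfl
      exacts [⟨_, this⟩, ⟨_, this.symm⟩]
    exact ((hadj z w).1 hw).2.1
  have hbp : b ∉ p.support := by
    intro h
    rcases hsupp b h with rfl | rfl | h
    exacts [hbx.ne rfl, hby.ne rfl, hbA h]
  have hlen2 : 2 ≤ p.length := by
    by_contra hlt
    have h1 : p.length = 0 ∨ p.length = 1 := by omega
    rcases h1 with h1 | h1
    · exact hxy (Walk.eq_of_length_eq_zero h1)
    · exact hn (hHG (Walk.adj_of_length_eq_one h1))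
  let q : G.Walk x b := (p.mapLe hHG).concat hby.symm
  have hq : q.IsPath := (Walk.concat_isPath_iff _).2 ⟨(Walk.isPath_mapLe hHG).2 hp,
    by simpa using hbp⟩
  have hqe : ∀ e, e ∈ q.edges ↔ e ∈ p.edges ∨ e = s(y, b) := by
    intro e; simp [q, Walk.edges_concat]
  have hqs : ∀ z, z ∈ q.support ↔ z ∈ p.support ∨ z = b := by
    intro z; simp [q, Walk.support_concat]
  have hcyc : (Walk.cons hbx q).IsCycle := by
    refine (Walk.cons_isCycle_iff _ _).2 ⟨hq, fun h => ?_⟩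
    rcases (hqe _).1 h with h | h
    · exact hbp (p.fst_mem_support_of_mem_edges h)
    · simp [hby.ne, hxy] at h
  obtain ⟨z, w, hzw, hz, hw, hne⟩ := hG _ _ hcyc (by simp [q]; omega)
  have hs : ∀ z, z ∈ (Walk.cons hbx q).support → z = b ∨ z ∈ p.support := by
    intro z hz; simp [hqs] at hz; tauto
  have hbN : ∀ z ∈ p.support, G.Adj b z → s(b, z) ∈ (Walk.cons hbx q).edges := by
    intro z hz h
    simp only [Walk.edges_cons, List.mem_cons, hqe]
    rcases hsupp z hz with rfl | rfl | h'
    · simp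
    · simp [Sym2.eq_swap]
    · exact absurd h (hb z h')
  rcases hs z hz with rfl | hzp <;> rcases hs w hw with rfl | hwp
  · exact hzw.ne rfl
  · exact hne (hbN w hwp hzw)
  · rw [Sym2.eq_swap] at hne
    exact hne (hbN z hzp hzw.symm)
  · refine hne ?_
    simp only [Walk.edges_cons, List.mem_cons, hqe]
    exact Or.inr (Or.inl (p.mem_edges_of_length_eq_dist hlen hzp hwp
      ((hadj _ _).2 ⟨hzw, hsupp _ hzp, hsupp _ hwp⟩)))

/-- Every nonempty set of vertices of a chordal graph has a simplicial vertex. -/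
theorem IsChordalGraph.exists_simplicial {V : Type} [DecidableEq V] {G : SimpleGraph V}
    (hG : IsChordalGraph G) (S : Finset V) (hS : S.Nonempty) :
    ∃ v ∈ S, ∀ x ∈ S, ∀ y ∈ S, G.Adj v x → G.Adj v y → x ≠ y → G.Adj x y := by
  classical
  induction S using Finset.strongInduction with | H S ih =>
  by_cases hcl : ∀ x ∈ S, ∀ y ∈ S, x ≠ y → G.Adj x y
  · obtain ⟨v, hv⟩ := hS
    exact ⟨v, hv, fun x hx y hy _ _ => hcl x hx y hy⟩
  push Not at hcl
  obtain ⟨a₀, ha₀, b₀, hb₀, hne₀, hnadj₀⟩ := hcl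
  let P : Finset V → Prop := fun A => A.Nonempty ∧
    (∀ a ∈ A, ∀ a' ∈ A, (G.induce (A : Set V)).spanningCoe.Reachable a a') ∧
    ∃ b ∈ S, b ∉ A ∧ ∀ a ∈ A, ¬ G.Adj b a
  have hP₀ : P {a₀} := by
    refine ⟨by simp, by simp, b₀, hb₀, by simpa using hne₀.symm, ?_⟩
    simpa using fun h => hnadj₀ h.symm
  obtain ⟨A, hA, hmax⟩ := Finset.exists_max_image (S.powerset.filter P) Finset.card
    ⟨{a₀}, by simp [ha₀, hP₀]⟩
  simp only [Finset.mem_filter, Finset.mem_powerset] at hA hmax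
  obtain ⟨hAS, ⟨a₁, ha₁⟩, hconn, b, hbS, hbA, hb⟩ := hA
  set B := S.filter (fun b => b ∉ A ∧ ∀ a ∈ A, ¬ G.Adj b a) with hB
  have hBS : B ⊂ S := by
    refine Finset.filter_ssubset.2 ⟨a₁, hAS ha₁, by simp [ha₁]⟩
  obtain ⟨v, hv, hsimp⟩ := ih B hBS ⟨b, by simp only [hB, Finset.mem_filter]; exact ⟨hbS, hbA, hb⟩⟩
  have hvB := hv
  simp only [hB, Finset.mem_filter] at hvB
  have hcross : ∀ x ∈ S, x ∉ B → x ∉ A → ∀ y ∈ B, G.Adj x y := by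
    intro x hx hxB hxA y hy
    by_contra hn
    have hyB := hy
    simp only [hB, Finset.mem_filter, not_and, not_forall, not_not] at hxB hyB
    obtain ⟨a, ha, hxa⟩ := hxB hx hxA
    have hmono : (G.induce (A : Set V)).spanningCoe ≤
        (G.induce ((insert x A : Finset V) : Set V)).spanningCoe := by
      intro p q h
      simp at h ⊢
      tauto
    have hxr : ∀ a' ∈ A, (G.induce ((insert x A : Finset V) : Set V)).spanningCoe.Reachable x a' :=
      fun a' ha' => (SimpleGraph.Adj.reachable (by simp [hxa, ha])).trans
        ((hconn a ha a' ha').mono hmono)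
    have hPx : P (insert x A) := by
      refine ⟨by simp, ?_, y, hyB.1, ?_, ?_⟩
      · intro p hp q hq
        rcases Finset.mem_insert.1 hp with rfl | hpA <;>
          rcases Finset.mem_insert.1 hq with rfl | hqA
        · rfl
        · exact hxr q hqA
        · exact (hxr p hpA).symm
        · exact (hconn p hpA q hqA).mono hmono
      · rw [Finset.mem_insert]
        rintro (rfl | h)
        · exact hyB.2.2 a ha hxa
        · exact hyB.2.1 h
      · intro c hc
        rcases Finset.mem_insert.1 hc with rfl | hc
        · exact fun h => hn h.symm
        · exact hyB.2.2 c hc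
    have := hmax (insert x A) ⟨Finset.insert_subset hx hAS, hPx⟩
    rw [Finset.card_insert_of_notMem hxA] at this
    omega
  refine ⟨v, hvB.1, fun x hx y hy hvx hvy hxy => ?_⟩
  have hxA : x ∉ A := fun h => hvB.2.2 x h hvx
  have hyA : y ∉ A := fun h => hvB.2.2 y h hvy
  by_cases hxB : x ∈ B <;> by_cases hyB : y ∈ B
  · exact hsimp x hxB y hyB hvx hvy hxy
  · exact (hcross y hy hyB hyA x hxB).symm
  · exact hcross x hx hxB hxA y hyB
  · simp only [hB, Finset.mem_filter, not_and, not_forall, not_not] at hxB hyB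
    obtain ⟨a, ha, hxa⟩ := hxB hx hxA
    obtain ⟨a', ha', hya⟩ := hyB hy hyA
    exact hG.adj_of_connected (A := (A : Set V)) hconn hvB.2.1 hvB.2.2 ha ha' hxa hya hvx hvy hxy

/-- A vertex `u` of a cycle of length at least four has two distinct neighbours on the cycle
that are not joined by an edge of the cycle. -/
theorem SimpleGraph.Walk.IsCycle.exists_mem_edges_notMem_edges {V : Type} {G : SimpleGraph V}
    {v : V} {c : G.Walk v v} (hc : c.IsCycle) (hlen : 4 ≤ c.length) {u : V} (hu : u ∈ c.support) :
    ∃ x y, x ≠ y ∧ s(u, x) ∈ c.edges ∧ s(u, y) ∈ c.edges ∧ s(x, y) ∉ c.edges := by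
  classical
  suffices H : ∀ c : G.Walk u u, c.IsCycle → 4 ≤ c.length →
      ∃ x y, x ≠ y ∧ s(u, x) ∈ c.edges ∧ s(u, y) ∈ c.edges ∧ s(x, y) ∉ c.edges by
    have hr : ∀ e, e ∈ (c.rotate u hu).edges ↔ e ∈ c.edges := fun _ =>
      (c.rotate_edges u hu).mem_iff
    obtain ⟨x, y, h⟩ := H (c.rotate u hu) ((Walk.isCycle_rotate hu).2 hc) (by
      rw [← Walk.length_edges, (c.rotate_edges u hu).perm.length_eq, Walk.length_edges]
      exact hlen)
    simp only [hr] at h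
    exact ⟨x, y, h⟩
  intro c hc hlen
  have hinj := hc.getVert_injOn
  have hend : c.getVert c.length = u := c.getVert_length
  have hinj' : ∀ i j, 1 ≤ i → i ≤ c.length → 1 ≤ j → j ≤ c.length →
      c.getVert i = c.getVert j → i = j :=
    fun i j h1 h2 h3 h4 h => hinj ⟨h1, h2⟩ ⟨h3, h4⟩ h
  simp only [← Walk.adj_toSubgraph_iff_mem_edges, Walk.toSubgraph_adj_iff]
  refine ⟨c.getVert 1, c.getVert (c.length - 1), fun h => ?_, ⟨0, by simp, by omega⟩,
    ⟨c.length - 1, ?_, by omega⟩, ?_⟩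
  · have := hinj' _ _ (by omega) (by omega) (by omega) (by omega) h
    omega
  · rw [Nat.sub_add_cancel (by omega), hend, Sym2.eq_swap]
  · rintro ⟨i, hi, hil⟩
    rcases Nat.eq_zero_or_pos i with rfl | hpos
    · replace hi : s(c.getVert c.length, c.getVert 1) =
          s(c.getVert 1, c.getVert (c.length - 1)) := by
        rw [hend]
        simpa using hi
      rcases Sym2.eq_iff.1 hi with h | h
      · have := hinj' _ _ (by omega) (by omega) (by omega) (by omega) h.1
        omega
      · have := hinj' _ _ (by omega) (by omega) (by omega) (by omega) h.1
        omega
    · rcases Sym2.eq_iff.1 hi with h | h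
      · have h1 := hinj' _ _ (by omega) (by omega) (by omega) (by omega) h.1
        have h2 := hinj' _ _ (by omega) (by omega) (by omega) (by omega) h.2
        omega
      · have h2 := hinj' _ _ (by omega) (by omega) (by omega) (by omega) h.2
        omega

/-- An antichain is the set of facets of the complex it generates. -/
theorem facets_gen {n : ℕ} {S : Set (Finset (Fin n))}
    (hS : ∀ F ∈ S, ∀ G ∈ S, F ⊆ G → F = G) : facets (gen S) = S := by
  ext F
  constructor
  · rintro ⟨⟨G, hG, hFG⟩, hmax⟩
    rwa [hmax G ⟨G, hG, subset_rfl⟩ hFG]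
  · refine fun hF => ⟨⟨F, hF, subset_rfl⟩, ?_⟩
    rintro G ⟨H, hH, hGH⟩ hFG
    exact hFG.antisymm (hGH.trans (hS F hF H hH (hFG.trans hGH)).superset)

/-- Every face is contained in a facet. -/
theorem exists_facet_superset {n : ℕ} {Δ : Set (Finset (Fin n))} {F : Finset (Fin n)}
    (hF : F ∈ Δ) : ∃ M ∈ facets Δ, F ⊆ M := by
  obtain ⟨M, hFM, hM⟩ := (Set.toFinite Δ).exists_le_maximal hF
  exact ⟨M, ⟨hM.prop, fun G hG h => h.antisymm (hM.le_of_ge hG h)⟩, hFM⟩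

/-- If no facet other than the leaf `F` contains both of its vertices `x` and `y`, then one of
them lies in no facet other than `F`. -/
theorem IsLeaf.exists_free {n : ℕ} {Δ : Set (Finset (Fin n))} {F : Finset (Fin n)}
    (hF : IsLeaf Δ F) {x y : Fin n} (hx : x ∈ F) (hy : y ∈ F)
    (hxy : ∀ H ∈ facets Δ, x ∈ H → y ∈ H → H = F) :
    ∃ u, (u = x ∨ u = y) ∧ ∀ H ∈ facets Δ, u ∈ H → H = F := by
  rcases hF.2 with h | ⟨B, hB, hBF, hbr⟩
  · exact ⟨x, Or.inl rfl, fun H hH _ => by rw [h] at hH; exact hH⟩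
  have key : ∀ u ∈ F, u ∉ B → ∀ H ∈ facets Δ, u ∈ H → H = F := by
    intro u hu huB H hH huH
    by_contra hne
    exact huB (Finset.mem_inter.1 (hbr H hH hne (Finset.mem_inter.2 ⟨huH, hu⟩))).1
  by_cases hxB : x ∈ B
  · exact ⟨y, Or.inr rfl, key y hy fun hyB => hBF (hxy B hB hxB hyB)⟩
  · exact ⟨x, Or.inl rfl, key x hx hxB⟩

/-- The 1-skeleton of a quasi-tree is chordal. -/
theorem IsQuasiTree.isChordalGraph {n : ℕ} {Δ : Set (Finset (Fin n))} (hΔ : IsQuasiTree Δ)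
    (hlow : IsLowerComplex Δ) {G : SimpleGraph (Fin n)}
    (hG : ∀ i j : Fin n, i ≠ j → (({i, j} : Finset (Fin n)) ∈ Δ ↔ G.Adj i j)) :
    IsChordalGraph G := by
  classical
  obtain ⟨L, -, hL, hleaf⟩ := hΔ
  intro v c hc hlen
  have hex : ∃ k, ∀ x y, s(x, y) ∈ c.edges → ∃ F ∈ L.take k, x ∈ F ∧ y ∈ F := by
    refine ⟨L.length, fun x y hxy => ?_⟩
    have hadj := c.adj_of_mem_edges hxy
    obtain ⟨M, hM, hsub⟩ := exists_facet_superset ((hG x y hadj.ne).2 hadj)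
    rw [← hL] at hM
    exact ⟨M, by simpa using hM, hsub (by simp), hsub (by simp)⟩
  obtain ⟨k, hk, hmin⟩ : ∃ k, (∀ x y, s(x, y) ∈ c.edges → ∃ F ∈ L.take k, x ∈ F ∧ y ∈ F) ∧
      ∀ m < k, ¬ ∀ x y, s(x, y) ∈ c.edges → ∃ F ∈ L.take m, x ∈ F ∧ y ∈ F :=
    ⟨Nat.find hex, Nat.find_spec hex, fun m hm => Nat.find_min hex hm⟩
  obtain ⟨x₀, y₀, -, he₀, -⟩ := hc.exists_mem_edges_notMem_edges hlen c.start_mem_support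
  obtain _ | m := k
  · obtain ⟨F, hF, -⟩ := hk _ _ he₀
    simp at hF
  have hm := hmin m (Nat.lt_succ_self m)
  push Not at hm
  obtain ⟨x, y, hxy, hnot⟩ := hm
  have hmL : m < L.length := by
    by_contra hge
    obtain ⟨F, hF, hxF, hyF⟩ := hk x y hxy
    rw [List.take_of_length_le (by omega)] at hF
    exact hnot F (by rwa [List.take_of_length_le (by omega)]) hxF hyF
  have htake : ∀ F, F ∈ L.take (m + 1) ↔ F ∈ L.take m ∨ F = L[m] := by
    intro F
    rw [List.take_add_one, List.getElem?_eq_getElem hmL, List.mem_append, Option.toList_some,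
      List.mem_singleton]
  have hfac : facets (gen {F | F ∈ L.take (m + 1)}) = {F | F ∈ L.take (m + 1)} := by
    refine facets_gen fun F hF H hH hFH => ?_
    have h1 : F ∈ facets Δ := by rw [← hL]; exact List.mem_of_mem_take hF
    have h2 : H ∈ facets Δ := by rw [← hL]; exact List.mem_of_mem_take hH
    exact h1.2 H h2.1 hFH
  have honly : ∀ H ∈ facets (gen {F | F ∈ L.take (m + 1)}), x ∈ H → y ∈ H → H = L[m] := by
    intro H hH hx hy
    rw [hfac] at hH
    rcases (htake H).1 hH with h | h
    · exact absurd hy (hnot H h hx)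
    · exact h
  obtain ⟨F, hF, hxF, hyF⟩ := hk x y hxy
  obtain rfl := honly F (by rw [hfac]; exact hF) hxF hyF
  obtain ⟨u, huxy, hu⟩ := (hleaf ⟨m, hmL⟩).exists_free hxF hyF honly
  have husupp : u ∈ c.support := by
    rcases huxy with rfl | rfl
    exacts [c.fst_mem_support_of_mem_edges hxy, c.snd_mem_support_of_mem_edges hxy]
  have hnb : ∀ z, s(u, z) ∈ c.edges → z ∈ L[m] := by
    intro z hz
    obtain ⟨H, hH, huH, hzH⟩ := hk u z hz
    have : H = L[m] := hu H (by rw [hfac]; exact hH) huH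
    rwa [← this]
  obtain ⟨a, b, hab, ha, hb, hne⟩ := hc.exists_mem_edges_notMem_edges hlen husupp
  have hmem : L[m] ∈ facets Δ := by rw [← hL]; exact List.getElem_mem hmL
  refine ⟨a, b, (hG a b hab).1 (hlow _ hmem.1 _ ?_), c.snd_mem_support_of_mem_edges ha,
    c.snd_mem_support_of_mem_edges hb, hne⟩
  intro z hz
  rcases Finset.mem_insert.1 hz with rfl | hz
  · exact hnb _ ha
  · rw [Finset.mem_singleton.1 hz]
    exact hnb _ hb

/-- The cliques contained in `S`. -/
def cliquesIn {n : ℕ} (G : SimpleGraph (Fin n)) (S : Finset (Fin n)) : Set (Finset (Fin n)) :=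
  {F | F ∈ cliqueComplex G ∧ F ⊆ S}

/-- Removing a simplicial vertex `v` with neighbourhood `N` in `S` replaces the maximal clique
`insert v N`, possibly by `N`. -/
theorem facets_cliquesIn {n : ℕ} {G : SimpleGraph (Fin n)} {S N : Finset (Fin n)} {v : Fin n}
    (hv : v ∈ S) (hN : ∀ x, x ∈ N ↔ x ∈ S ∧ G.Adj v x) (hNc : N ∈ cliqueComplex G) :
    facets (cliquesIn G S) = insert (insert v N) (facets (cliquesIn G (S.erase v)) \ {N}) := by
  have hvN : v ∉ N := fun h => G.irrefl ((hN v).1 h).2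
  have hins : insert v N ∈ cliquesIn G S := by
    refine ⟨fun i hi j hj hij => ?_, ?_⟩
    · rcases Finset.mem_insert.1 hi with rfl | hi' <;> rcases Finset.mem_insert.1 hj with rfl | hj'
      · exact absurd rfl hij
      · exact ((hN j).1 hj').2
      · exact ((hN i).1 hi').2.symm
      · exact hNc i hi' j hj' hij
    · exact Finset.insert_subset hv fun x hx => ((hN x).1 hx).1
  have hsub : ∀ F ∈ cliquesIn G S, v ∈ F → F ⊆ insert v N := by
    intro F hF hvF x hx
    by_cases hxv : x = v
    · simp [hxv]
    · exact Finset.mem_insert_of_mem ((hN x).2 ⟨hF.2 hx, hF.1 v hvF x hx (Ne.symm hxv)⟩)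
  have hmono : ∀ F ∈ cliquesIn G (S.erase v), F ∈ cliquesIn G S ∧ v ∉ F := fun F hF =>
    ⟨⟨hF.1, hF.2.trans (Finset.erase_subset _ _)⟩, fun h => by simpa using hF.2 h⟩
  have hres : ∀ F ∈ cliquesIn G S, v ∉ F → F ∈ cliquesIn G (S.erase v) := fun F hF hvF =>
    ⟨hF.1, Finset.subset_erase.2 ⟨hF.2, hvF⟩⟩
  have hNin : N ∈ cliquesIn G (S.erase v) :=
    ⟨hNc, fun x hx => Finset.mem_erase.2 ⟨fun h => hvN (h ▸ hx), ((hN x).1 hx).1⟩⟩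
  ext F
  simp only [Set.mem_insert_iff, Set.mem_sdiff, Set.mem_singleton_iff]
  constructor
  · rintro ⟨hF, hmax⟩
    by_cases hvF : v ∈ F
    · exact Or.inl (hmax _ hins (hsub F hF hvF))
    · refine Or.inr ⟨⟨hres F hF hvF, fun H hH => hmax H (hmono H hH).1⟩, ?_⟩
      rintro rfl
      exact hvF (hmax _ hins (Finset.subset_insert _ _) ▸ Finset.mem_insert_self _ _)
  · rintro (rfl | ⟨⟨hF, hmax⟩, hne⟩)
    · exact ⟨hins, fun H hH hsubH =>
        hsubH.antisymm (hsub H hH (hsubH (Finset.mem_insert_self _ _)))⟩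
    · refine ⟨(hmono F hF).1, fun H hH hFH => ?_⟩
      by_cases hvH : v ∈ H
      · refine absurd (hmax N hNin fun x hx => ?_) hne
        refine (Finset.mem_insert.1 (hsub H hH hvH (hFH hx))).resolve_left ?_
        rintro rfl
        exact (hmono F hF).2 hx
      · exact hmax H (hres H hH hvH) hFH

/-- The maximal cliques of a chordal graph can be enumerated so that each but the first has a
branch among its predecessors. -/
theorem IsChordalGraph.exists_leaf_order {n : ℕ} {G : SimpleGraph (Fin n)}
    (hG : IsChordalGraph G) (S : Finset (Fin n)) :
    ∃ (m : ℕ) (f : ℕ → Finset (Fin n)), Set.InjOn f (Set.Iio m) ∧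
      f '' Set.Iio m = facets (cliquesIn G S) ∧
      ∀ i < m, 0 < i → ∃ j < i, ∀ k < i, f k ∩ f i ⊆ f j := by
  classical
  induction S using Finset.strongInduction with | H S ih =>
  rcases S.eq_empty_or_nonempty with rfl | hS
  · refine ⟨1, fun _ => ∅, fun i hi j hj _ => ?_, ?_, fun i hi h => by omega⟩
    · simp only [Set.mem_Iio] at hi hj
      omega
    · ext F
      simp only [Set.mem_image, Set.mem_Iio, facets, cliquesIn, cliqueComplex,
        Finset.subset_empty]
      constructor
      · rintro ⟨i, -, rfl⟩
        exact ⟨⟨by simp, rfl⟩, fun H hH _ => hH.2.symm⟩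
      · rintro ⟨⟨-, rfl⟩, -⟩
        exact ⟨0, by simp, rfl⟩
  obtain ⟨v, hv, hsimp⟩ := hG.exists_simplicial S hS
  obtain ⟨m, f, hinj, himg, hleaf⟩ := ih (S.erase v) (Finset.erase_ssubset hv)
  set N := S.filter (G.Adj v) with hNdef
  have hN : ∀ x, x ∈ N ↔ x ∈ S ∧ G.Adj v x := by simp [hNdef]
  have hNc : N ∈ cliqueComplex G := fun x hx y hy =>
    hsimp x ((hN x).1 hx).1 y ((hN y).1 hy).1 ((hN x).1 hx).2 ((hN y).1 hy).2
  have hvN : v ∉ N := fun h => G.irrefl ((hN v).1 h).2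
  have hvf : ∀ i < m, v ∉ f i := by
    intro i hi h
    have : f i ∈ facets (cliquesIn G (S.erase v)) := himg ▸ Set.mem_image_of_mem f hi
    simpa using this.1.2 h
  have hfne : ∀ i < m, f i ≠ insert v N := fun i hi h =>
    hvf i hi (h ▸ Finset.mem_insert_self _ _)
  rw [facets_cliquesIn hv hN hNc, ← himg]
  by_cases hNf : ∃ i₀ < m, f i₀ = N
  · obtain ⟨i₀, hi₀, hfi₀⟩ := hNf
    refine ⟨m, Function.update f i₀ (insert v N), ?_, ?_, ?_⟩
    · intro i hi j hj hij
      simp only [Function.update_apply] at hij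
      split_ifs at hij with h1 h2 h2
      · rw [h1, h2]
      · exact absurd hij.symm (hfne j hj)
      · exact absurd hij (hfne i hi)
      · exact hinj hi hj hij
    · ext F
      simp only [Set.mem_image, Set.mem_Iio, Set.mem_insert_iff, Set.mem_sdiff,
        Set.mem_singleton_iff, Function.update_apply]
      constructor
      · rintro ⟨i, hi, rfl⟩
        split_ifs with h
        · exact Or.inl rfl
        · exact Or.inr ⟨⟨i, hi, rfl⟩, fun h' => h (hinj hi hi₀ (h'.trans hfi₀.symm))⟩
      · rintro (rfl | ⟨⟨i, hi, rfl⟩, hne⟩)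
        · exact ⟨i₀, hi₀, by simp⟩
        · refine ⟨i, hi, if_neg ?_⟩
          rintro rfl
          exact hne hfi₀
    · intro i hi hpos
      obtain ⟨j, hj, hbr⟩ := hleaf i hi hpos
      refine ⟨j, hj, fun k hk x hx => ?_⟩
      have hle : ∀ l, f l ⊆ Function.update f i₀ (insert v N) l := by
        intro l
        rw [Function.update_apply]
        split_ifs with h
        · rw [h, hfi₀]
          exact Finset.subset_insert _ _
        · rfl
      have hmem : ∀ l, x ∈ Function.update f i₀ (insert v N) l → x ∈ f l ∨ (l = i₀ ∧ x = v) := by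
        intro l hl
        rw [Function.update_apply] at hl
        split_ifs at hl with h
        · rcases Finset.mem_insert.1 hl with h' | h'
          · exact Or.inr ⟨h, h'⟩
          · exact Or.inl (by rwa [h, hfi₀])
        · exact Or.inl hl
      obtain ⟨hxk, hxi⟩ := Finset.mem_inter.1 hx
      rcases hmem k hxk with h1 | ⟨h1, rfl⟩ <;> rcases hmem i hxi with h2 | ⟨h2, h3⟩
      · exact hle j (hbr k hk (Finset.mem_inter.2 ⟨h1, h2⟩))
      · exact absurd (h3 ▸ h1) (hvf k (by omega))
      · exact absurd h2 (hvf i hi)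
      · omega
  · push Not at hNf
    have hlt : ∀ i < m, Function.update f m (insert v N) i = f i := fun i hi =>
      Function.update_of_ne (by omega) _ _
    have hself : Function.update f m (insert v N) m = insert v N := Function.update_self _ _ _
    refine ⟨m + 1, Function.update f m (insert v N), ?_, ?_, ?_⟩
    · intro i hi j hj hij
      simp only [Set.mem_Iio, Nat.lt_succ_iff_lt_or_eq] at hi hj
      rcases hi with hi | rfl <;> rcases hj with hj | rfl
      · rw [hlt i hi, hlt j hj] at hij
        exact hinj hi hj hij
      · rw [hlt i hi, hself] at hij
        exact absurd hij (hfne i hi)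
      · rw [hlt j hj, hself] at hij
        exact absurd hij.symm (hfne j hj)
      · rfl
    · ext F
      simp only [Set.mem_image, Set.mem_Iio, Set.mem_insert_iff, Set.mem_sdiff,
        Set.mem_singleton_iff, Nat.lt_succ_iff_lt_or_eq]
      constructor
      · rintro ⟨i, hi | rfl, rfl⟩
        · rw [hlt i hi]
          exact Or.inr ⟨⟨i, hi, rfl⟩, hNf i hi⟩
        · exact Or.inl hself
      · rintro (rfl | ⟨⟨i, hi, rfl⟩, -⟩)
        · exact ⟨m, Or.inr rfl, hself⟩
        · exact ⟨i, Or.inl hi, hlt i hi⟩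
    · intro i hi hpos
      rcases Nat.lt_succ_iff_lt_or_eq.1 hi with hi | rfl
      · obtain ⟨j, hj, hbr⟩ := hleaf i hi hpos
        refine ⟨j, hj, fun k hk => ?_⟩
        rw [hlt i hi, hlt j (by omega), hlt k (by omega)]
        exact hbr k hk
      · have hNin : N ∈ cliquesIn G (S.erase v) :=
          ⟨hNc, fun x hx => Finset.mem_erase.2 ⟨fun h => hvN (h ▸ hx), ((hN x).1 hx).1⟩⟩
        obtain ⟨M, hM, hNM⟩ := exists_facet_superset hNin
        rw [← himg] at hM
        obtain ⟨j, hj, rfl⟩ := hM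
        refine ⟨j, hj, fun k hk x hx => ?_⟩
        rw [hlt k hk, hself] at hx
        rw [hlt j hj]
        obtain ⟨hxk, hxN⟩ := Finset.mem_inter.1 hx
        refine hNM ((Finset.mem_insert.1 hxN).resolve_left ?_)
        rintro rfl
        exact hvf k hk hxk

/-- The clique complex of a chordal graph is a quasi-tree. -/
theorem IsChordalGraph.isQuasiTree_cliqueComplex {n : ℕ} {G : SimpleGraph (Fin n)}
    (hG : IsChordalGraph G) : IsQuasiTree (cliqueComplex G) := by
  obtain ⟨m, f, hinj, himg, hleaf⟩ := hG.exists_leaf_order Finset.univ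
  have huniv : cliquesIn G Finset.univ = cliqueComplex G := by simp [cliquesIn]
  rw [huniv] at himg
  refine ⟨(List.range m).map f, ?_, ?_, ?_⟩
  · exact List.Nodup.map_on (fun x hx y hy => hinj (by simpa using hx) (by simpa using hy))
      List.nodup_range
  · rw [← himg]
    ext F
    simp
  rintro ⟨i, hi⟩
  have him : i < m := by simpa using hi
  have hset : {F | F ∈ ((List.range m).map f).take (i + 1)} = f '' Set.Iio (i + 1) := by
    ext F
    rw [← List.map_take, List.take_range, min_eq_left (by omega)]
    simp
  have hfac : facets (gen (f '' Set.Iio (i + 1))) = f '' Set.Iio (i + 1) := by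
    have hsub : f '' Set.Iio (i + 1) ⊆ facets (cliqueComplex G) := by
      rw [← himg]
      exact Set.image_mono (Set.Iio_subset_Iio (by omega))
    exact facets_gen fun F hF H hH => (hsub hF).2 H (hsub hH).1
  have hget : ((List.range m).map f).get ⟨i, hi⟩ = f i := by simp
  rw [hget]
  simp only [hset]
  rw [IsLeaf, hfac]
  refine ⟨⟨i, by simp, rfl⟩, ?_⟩
  rcases Nat.eq_zero_or_pos i with rfl | hpos
  · left
    ext F
    simp
  · obtain ⟨j, hj, hbr⟩ := hleaf i him hpos
    refine Or.inr ⟨f j, ⟨j, by simp; omega, rfl⟩, fun h => ?_, ?_⟩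
    · have := hinj (show j < m by omega) him h
      omega
    · rintro _ ⟨k, hk, rfl⟩ hne
      have hki : k ≠ i := fun h => hne (h ▸ rfl)
      simp only [Set.mem_Iio] at hk
      exact Finset.subset_inter (hbr k (by omega)) Finset.inter_subset_right

/-- Dirac's theorem: A finite simple graph `G` on `[n]` is chordal if
and only if `G` is the 1-skeleton of a quasi-tree on `[n]`, i.e. there is a quasi-tree
`Δ` on `[n]` whose 2-element faces are exactly the edges of `G`. -/
theorem stmt_14 {n : ℕ} (G : SimpleGraph (Fin n)) :
    IsChordalGraph G ↔
      ∃ Δ : Set (Finset (Fin n)), IsComplex Δ ∧ IsQuasiTree Δ ∧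
        ∀ i j : Fin n, i ≠ j → (({i, j} : Finset (Fin n)) ∈ Δ ↔ G.Adj i j) := by
  constructor
  · refine fun hG => ⟨cliqueComplex G, ⟨fun i x hx y hy hxy => ?_, fun F hF H hH x hx y hy =>
      hF x (hH hx) y (hH hy)⟩, hG.isQuasiTree_cliqueComplex, fun i j hij => ⟨fun h =>
      h i (by simp) j (by simp) hij, fun h x hx y hy hxy => ?_⟩⟩
    · rw [Finset.mem_singleton] at hx hy
      exact absurd (hx.trans hy.symm) hxy
    · rw [Finset.mem_insert, Finset.mem_singleton] at hx hy
      rcases hx with rfl | rfl <;> rcases hy with rfl | rfl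
      exacts [absurd rfl hxy, h, h.symm, absurd rfl hxy]
  · rintro ⟨Δ, hc, hq, hG⟩
    exact hq.isChordalGraph hc.2 hG
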